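/- There exists a constant c₂ > 0 such that the following holds for all r > 0 and 0 < ε ≤ 1. Let x₁, …, x_k ∈ ℝ² be points such that ‖x_i − x_j‖₂ ≥ r√ε for all i ≠ j. Let A_i = A_ε(x_i, r) and let B_i = B̄(x_i, r√ε) be the closed Euclidean ball of radius r√ε centered at x_i. Then for every index i, |A_i ∩ ⋃_{j ≠ i} (A_j ∪ B_j)| ≤ c₂ · k · |A_ε(0, r)| · √ε. -/

import Mathlib

open MeasureTheory

/-- The closed annulus centered at `x` with inner radius `r*(1-ε)` and outer radius `r`. -/
def annulus (x : EuclideanSpace ℝ (Fin 2)) (r ε : ℝ) : Set (EuclideanSpace ℝ (Fin 2)) :=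
  {y | r * (1 - ε) ≤ dist y x ∧ dist y x ≤ r}

theorem annulus_subset_closedBall (x : EuclideanSpace ℝ (Fin 2)) (r ε : ℝ) :
    annulus x r ε ⊆ Metric.closedBall x r :=
  fun _ hy => hy.2

theorem volume_annulus_ne_top (x : EuclideanSpace ℝ (Fin 2)) (r ε : ℝ) :
    volume (annulus x r ε) ≠ ⊤ :=
  measure_ne_top_of_subset (annulus_subset_closedBall x r ε) measure_closedBall_lt_top.ne

theorem volume_annulus_eq_volume_annulus_zero (x : EuclideanSpace ℝ (Fin 2)) (r ε : ℝ) :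
    volume (annulus x r ε) = volume (annulus 0 r ε) := by
  have h : annulus x r ε = (fun y => y - x) ⁻¹' annulus 0 r ε := by
    ext y
    simp [annulus, dist_eq_norm]
  rw [h]
  simp only [sub_eq_add_neg]
  exact measure_preimage_add_right volume (-x) _

theorem sq_mul_le_volume_annulus {r ε : ℝ} (hr : 0 ≤ r) (hε0 : 0 ≤ ε) (hε1 : ε ≤ 1) :
    r ^ 2 * ε ≤ (volume (annulus 0 r ε)).toReal := by
  have hin : 0 ≤ r * (1 - ε) := mul_nonneg hr (by linarith)
  have hsub : Metric.closedBall (0 : EuclideanSpace ℝ (Fin 2)) r \ Metric.ball 0 (r * (1 - ε)) ⊆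
      annulus 0 r ε := by
    rintro y ⟨h1, h2⟩
    exact ⟨not_lt.1 h2, h1⟩
  have hle := ENNReal.toReal_mono (volume_annulus_ne_top 0 r ε) (measure_mono hsub)
  have hball : Metric.ball (0 : EuclideanSpace ℝ (Fin 2)) (r * (1 - ε)) ⊆ Metric.closedBall 0 r :=
    Metric.ball_subset_closedBall.trans (Metric.closedBall_subset_closedBall (by nlinarith))
  rw [← measureReal_def, measureReal_sdiff hball measurableSet_ball measure_closedBall_lt_top.ne, measureReal_def,
    measureReal_def, EuclideanSpace.volume_ball_fin_two, EuclideanSpace.volume_closedBall_fin_two]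
    at hle
  simp only [ENNReal.toReal_mul, ENNReal.toReal_pow, ENNReal.toReal_ofReal hr,
    ENNReal.toReal_ofReal hin, ENNReal.toReal_ofReal Real.pi_nonneg] at hle
  have hpos : 0 ≤ r ^ 2 * ε := by positivity
  have hpi := Real.pi_gt_three
  have : r ^ 2 * ε ≤ r ^ 2 * ε * (2 - ε) * Real.pi := by
    nlinarith [mul_nonneg hpos (show (0 : ℝ) ≤ 1 - ε by linarith), mul_nonneg hpos
      (mul_nonneg (show (0 : ℝ) ≤ 2 - ε by linarith) (show (0 : ℝ) ≤ Real.pi - 3 by linarith))]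
  linarith

theorem exists_orthonormalBasis_zero_eq {e : EuclideanSpace ℝ (Fin 2)} (he : ‖e‖ = 1) :
    ∃ b : OrthonormalBasis (Fin 2) ℝ (EuclideanSpace ℝ (Fin 2)), b 0 = e := by
  have hv : Orthonormal ℝ (({0} : Set (Fin 2)).domRestrict fun _ => e) :=
    ⟨fun _ => he, fun i j hij => (hij (Subsingleton.elim i j)).elim⟩
  obtain ⟨b, hb⟩ := hv.exists_orthonormalBasis_extension_of_card_eq (by simp)
  exact ⟨b, hb 0 rfl⟩

theorem volume_setOf_sq_mem_le {a b : ℝ} (hab : a ≤ b) :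
    volume {t : ℝ | a ≤ t ^ 2 ∧ t ^ 2 ≤ b} ≤ ENNReal.ofReal (2 * (√b - √a)) := by
  have hsub : {t : ℝ | a ≤ t ^ 2 ∧ t ^ 2 ≤ b} ⊆ Set.Icc (√a) (√b) ∪ Set.Icc (-√b) (-√a) := by
    rintro t ⟨h1, h2⟩
    have h3 := Real.sqrt_le_sqrt h1
    have h4 := Real.sqrt_le_sqrt h2
    rw [Real.sqrt_sq_eq_abs] at h3 h4
    rcases abs_cases t with ⟨h, _⟩ | ⟨h, _⟩ <;> rw [h] at h3 h4
    · exact Or.inl ⟨h3, h4⟩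
    · exact Or.inr ⟨by linarith, by linarith⟩
  have hs := Real.sqrt_le_sqrt hab
  refine (measure_mono hsub).trans ((measure_union_le _ _).trans ?_)
  rw [Real.volume_Icc, Real.volume_Icc, ← ENNReal.ofReal_add (by linarith) (by linarith)]
  exact ENNReal.ofReal_le_ofReal (by linarith)

theorem volume_setOf_sq_mem_le_sqrt_sub {a b : ℝ} (hab : a ≤ b) :
    volume {t : ℝ | a ≤ t ^ 2 ∧ t ^ 2 ≤ b} ≤ ENNReal.ofReal (2 * √(b - a)) := by
  refine (volume_setOf_sq_mem_le hab).trans (ENNReal.ofReal_le_ofReal ?_)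
  have : √b ≤ √a + √(b - a) := by
    refine Real.sqrt_le_iff.2 ⟨by positivity, ?_⟩
    have h1 : a ≤ √a ^ 2 := by
      rw [Real.sq_sqrt']
      exact le_max_left a 0
    nlinarith [Real.sq_sqrt (sub_nonneg.2 hab), mul_nonneg (Real.sqrt_nonneg a)
      (Real.sqrt_nonneg (b - a))]
  linarith

theorem volume_setOf_sq_mem_le_sub_div {a b m : ℝ} (hab : a ≤ b) (hm : 0 < m) (hma : m ^ 2 ≤ a) :
    volume {t : ℝ | a ≤ t ^ 2 ∧ t ^ 2 ≤ b} ≤ ENNReal.ofReal ((b - a) / m) := by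
  refine (volume_setOf_sq_mem_le hab).trans (ENNReal.ofReal_le_ofReal ?_)
  have ha : 0 ≤ a := (sq_nonneg m).trans hma
  have h1 : m ≤ √a := Real.le_sqrt_of_sq_le hma
  have h2 := Real.sqrt_le_sqrt hab
  rw [le_div_iff₀ hm]
  nlinarith [Real.sq_sqrt ha, Real.sq_sqrt (ha.trans hab)]

theorem volume_annulus_inter_strip_le (b : OrthonormalBasis (Fin 2) ℝ (EuclideanSpace ℝ (Fin 2)))
    (x : EuclideanSpace ℝ (Fin 2)) {r ε c h L : ℝ} (hr : 0 ≤ r) (hε1 : ε ≤ 1)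
    (hL : ∀ s, |s - c| ≤ h →
      volume {t : ℝ | (r * (1 - ε)) ^ 2 - s ^ 2 ≤ t ^ 2 ∧ t ^ 2 ≤ r ^ 2 - s ^ 2} ≤
        ENNReal.ofReal L) :
    volume (annulus x r ε ∩ {y | |inner ℝ (b 0) (y - x) - c| ≤ h}) ≤
      ENNReal.ofReal L * ENNReal.ofReal (2 * h) := by
  let g : EuclideanSpace ℝ (Fin 2) → ℝ × ℝ :=
    fun y => (b.repr (y - x) 0, b.repr (y - x) 1)
  have hg : MeasurePreserving g volume volume :=
    (volume_preserving_finTwoArrow ℝ).comp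
      ((EuclideanSpace.volume_preserving_symm_measurableEquiv_toLp (Fin 2)).comp
        (b.measurePreserving_repr.comp (measurePreserving_sub_right volume x)))
  let T : Set (ℝ × ℝ) := {p | |p.1 - c| ≤ h} ∩
    ({p | (r * (1 - ε)) ^ 2 - p.1 ^ 2 ≤ p.2 ^ 2} ∩ {p | p.2 ^ 2 ≤ r ^ 2 - p.1 ^ 2})
  have hT : MeasurableSet T := by
    refine .inter ?_ (.inter ?_ ?_) <;> apply measurableSet_le <;> fun_prop
  have hsub : annulus x r ε ∩ {y | |inner ℝ (b 0) (y - x) - c| ≤ h} ⊆ g ⁻¹' T := by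
    rintro y ⟨⟨h1, h2⟩, h3⟩
    have hn : dist y x ^ 2 = b.repr (y - x) 0 ^ 2 + b.repr (y - x) 1 ^ 2 := by
      rw [dist_eq_norm, ← b.repr.norm_map, EuclideanSpace.real_norm_sq_eq, Fin.sum_univ_two]
    have h4 := pow_le_pow_left₀ (mul_nonneg hr (by linarith)) h1 2
    have h5 := pow_le_pow_left₀ dist_nonneg h2 2
    refine ⟨?_, ?_, ?_⟩
    · change |b.repr (y - x) 0 - c| ≤ h
      rwa [b.repr_apply_apply]
    · change _ - b.repr (y - x) 0 ^ 2 ≤ b.repr (y - x) 1 ^ 2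
      linarith
    · change b.repr (y - x) 1 ^ 2 ≤ _ - b.repr (y - x) 0 ^ 2
      linarith
  calc _ ≤ volume (g ⁻¹' T) := measure_mono hsub
    _ = volume T := hg.measure_preimage hT.nullMeasurableSet
    _ = ∫⁻ s, volume (Prod.mk s ⁻¹' T) := Measure.prod_apply hT
    _ ≤ ∫⁻ s, (Set.Icc (c - h) (c + h)).indicator (fun _ => ENNReal.ofReal L) s := by
      refine lintegral_mono fun s => ?_
      by_cases hs : |s - c| ≤ h
      · have hmem : s ∈ Set.Icc (c - h) (c + h) := by
          rw [abs_le] at hs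
          exact ⟨by linarith, by linarith⟩
        rw [Set.indicator_of_mem hmem]
        exact (measure_mono fun t ht => ht.2).trans (hL s hs)
      · have : Prod.mk s ⁻¹' T = ∅ := Set.eq_empty_of_forall_notMem fun t ht => hs ht.1
        simp [this]
    _ = ENNReal.ofReal L * ENNReal.ofReal (2 * h) := by
      rw [lintegral_indicator_const measurableSet_Icc, Real.volume_Icc]
      congr 2
      ring

theorem volume_annulus_section_le {r ε s : ℝ} (hr : 0 < r) (hε0 : 0 ≤ ε) (hε : ε ≤ 1 / 64)
    (hs : |s| ≤ 5 / 8 * r) :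
    volume {t : ℝ | (r * (1 - ε)) ^ 2 - s ^ 2 ≤ t ^ 2 ∧ t ^ 2 ≤ r ^ 2 - s ^ 2} ≤
      ENNReal.ofReal (4 * r * ε) := by
  have hs2 : s ^ 2 ≤ (5 / 8 * r) ^ 2 := sq_le_sq' (by linarith [abs_le.1 hs]) (abs_le.1 hs).2
  have h1 : (r * (63 / 64)) ^ 2 ≤ (r * (1 - ε)) ^ 2 :=
    pow_le_pow_left₀ (by positivity) (mul_le_mul_of_nonneg_left (by linarith) hr.le) 2
  have h2 : (r * (1 - ε)) ^ 2 ≤ (r * 1) ^ 2 :=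
    pow_le_pow_left₀ (mul_nonneg hr.le (by linarith))
      (mul_le_mul_of_nonneg_left (by linarith) hr.le) 2
  refine (volume_setOf_sq_mem_le_sub_div (m := r / 2) (by linarith) (by positivity)
    (by nlinarith)).trans (ENNReal.ofReal_le_ofReal ?_)
  rw [div_le_iff₀ (by positivity)]
  nlinarith [sq_nonneg (r * ε)]

theorem volume_annulus_section_le_sqrt {r ε : ℝ} (s : ℝ) (hr : 0 ≤ r) (hε0 : 0 ≤ ε)
    (hε1 : ε ≤ 1) :
    volume {t : ℝ | (r * (1 - ε)) ^ 2 - s ^ 2 ≤ t ^ 2 ∧ t ^ 2 ≤ r ^ 2 - s ^ 2} ≤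
      ENNReal.ofReal (4 * r * √ε) := by
  have h2 : (r * (1 - ε)) ^ 2 ≤ (r * 1) ^ 2 :=
    pow_le_pow_left₀ (mul_nonneg hr (by linarith))
      (mul_le_mul_of_nonneg_left (by linarith) hr) 2
  refine (volume_setOf_sq_mem_le_sqrt_sub (by linarith)).trans (ENNReal.ofReal_le_ofReal ?_)
  have : √(r ^ 2 - s ^ 2 - ((r * (1 - ε)) ^ 2 - s ^ 2)) ≤ 2 * r * √ε := by
    refine Real.sqrt_le_iff.2 ⟨by positivity, ?_⟩
    rw [mul_pow (2 * r), Real.sq_sqrt hε0]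
    nlinarith [sq_nonneg (r * ε), mul_nonneg (sq_nonneg r) hε0]
  linarith

theorem volume_annulus_inter_annulus_le {r ε : ℝ} (hr : 0 < r) (hε0 : 0 < ε) (hε : ε ≤ 1 / 64)
    {x z : EuclideanSpace ℝ (Fin 2)} (hxz : r * √ε ≤ dist x z) :
    volume (annulus x r ε ∩ annulus z r ε) ≤ ENNReal.ofReal (8 * r ^ 2 * ε * √ε) := by
  set d := dist x z with hd
  have hq : 0 < √ε := Real.sqrt_pos.2 hε0
  have hq2 : √ε ^ 2 = ε := Real.sq_sqrt hε0.le
  have hq8 : √ε ≤ 1 / 8 := Real.sqrt_le_iff.2 ⟨by norm_num, by linarith⟩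
  have hd0 : 0 < d := lt_of_lt_of_le (by positivity) hxz
  have hnorm : ‖z - x‖ = d := by rw [hd, dist_comm, dist_eq_norm]
  obtain ⟨b, hb⟩ := exists_orthonormalBasis_zero_eq (e := d⁻¹ • (z - x))
    (by rw [norm_smul, hnorm, norm_inv, Real.norm_of_nonneg hd0.le, inv_mul_cancel₀ hd0.ne'])
  have hsub : annulus x r ε ∩ annulus z r ε ⊆
      annulus x r ε ∩ {y | |inner ℝ (b 0) (y - x) - d / 2| ≤ r ^ 2 * ε / d} := by
    rintro y ⟨hx, hz⟩
    refine ⟨hx, ?_⟩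
    have hin : 0 ≤ r * (1 - ε) := mul_nonneg hr.le (by linarith)
    have h1 := pow_le_pow_left₀ hin hx.1 2
    have h2 := pow_le_pow_left₀ dist_nonneg hx.2 2
    have h3 := pow_le_pow_left₀ hin hz.1 2
    have h4 := pow_le_pow_left₀ dist_nonneg hz.2 2
    have hpol : dist y z ^ 2 = dist y x ^ 2 - 2 * inner ℝ (z - x) (y - x) + d ^ 2 := by
      rw [dist_eq_norm, dist_eq_norm, ← hnorm, real_inner_comm, ← norm_sub_sq_real,
        sub_sub_sub_cancel_right]
    have hinner : inner ℝ (b 0) (y - x) - d / 2 = (inner ℝ (z - x) (y - x) - d ^ 2 / 2) / d := by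
      rw [hb, real_inner_smul_left]
      field_simp
    rw [Set.mem_ofPred_eq, hinner, abs_div, abs_of_pos hd0]
    gcongr
    rw [abs_le]
    constructor <;> nlinarith [sq_nonneg (r * ε)]
  refine (measure_mono hsub).trans ?_
  rcases lt_or_ge d r with hdr | hdr
  · have hw : r ^ 2 * ε / d ≤ r * √ε := by
      rw [div_le_iff₀ hd0]
      nlinarith [mul_le_mul_of_nonneg_left hxz (mul_nonneg hr.le hq.le)]
    refine (volume_annulus_inter_strip_le b x (L := 4 * r * ε) hr.le (by linarith)
      fun s hs => volume_annulus_section_le hr hε0.le hε ?_).trans ?_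
    · rw [abs_le] at hs ⊢
      constructor <;> nlinarith
    · rw [← ENNReal.ofReal_mul (by positivity)]
      refine ENNReal.ofReal_le_ofReal ?_
      nlinarith [mul_le_mul_of_nonneg_left hw (mul_nonneg hr.le hε0.le)]
  · have hw : r ^ 2 * ε / d ≤ r * ε := by
      rw [div_le_iff₀ hd0]
      nlinarith [mul_le_mul_of_nonneg_left hdr (mul_nonneg hr.le hε0.le)]
    refine (volume_annulus_inter_strip_le b x (L := 4 * r * √ε) hr.le (by linarith)
      fun s _ => volume_annulus_section_le_sqrt s hr.le hε0.le (by linarith)).trans ?_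
    rw [← ENNReal.ofReal_mul (by positivity)]
    refine ENNReal.ofReal_le_ofReal ?_
    nlinarith [mul_le_mul_of_nonneg_left hw (mul_nonneg hr.le hq.le)]

theorem volume_annulus_inter_closedBall_le {r ε : ℝ} (hr : 0 < r) (hε0 : 0 ≤ ε)
    (hε : ε ≤ 1 / 64) {x z : EuclideanSpace ℝ (Fin 2)} (hxz : x ≠ z) :
    volume (annulus x r ε ∩ Metric.closedBall z (r * √ε)) ≤
      ENNReal.ofReal (8 * r ^ 2 * ε * √ε) := by
  have hq8 : √ε ≤ 1 / 8 := Real.sqrt_le_iff.2 ⟨by norm_num, by linarith⟩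
  have hd0 : 0 < ‖z - x‖ := norm_pos_iff.2 (sub_ne_zero.2 hxz.symm)
  obtain ⟨b', hb'⟩ := exists_orthonormalBasis_zero_eq (e := ‖z - x‖⁻¹ • (z - x))
    (by rw [norm_smul, norm_inv, norm_norm, inv_mul_cancel₀ hd0.ne'])
  obtain ⟨b, hb⟩ := exists_orthonormalBasis_zero_eq (b'.norm_eq_one 1)
  have horth : inner ℝ (b 0) (z - x) = 0 := by
    have h := b'.inner_eq_zero (i := 1) (j := 0) (by decide)
    rw [hb', real_inner_smul_right] at h
    rw [hb]
    exact (mul_eq_zero.1 h).resolve_left (inv_ne_zero hd0.ne')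
  have hsub : annulus x r ε ∩ Metric.closedBall z (r * √ε) ⊆
      annulus x r ε ∩ {y | |inner ℝ (b 0) (y - x) - 0| ≤ r * √ε} := by
    rintro y ⟨hx, hz⟩
    refine ⟨hx, ?_⟩
    have h : inner ℝ (b 0) (y - x) = inner ℝ (b 0) (y - z) := by
      rw [← sub_add_sub_cancel y z x, inner_add_right, horth, add_zero]
    rw [Set.mem_ofPred_eq, sub_zero, h]
    refine (abs_real_inner_le_norm _ _).trans ?_
    rw [b.norm_eq_one, one_mul, ← dist_eq_norm]
    exact hz
  refine (measure_mono hsub).trans ((volume_annulus_inter_strip_le b x (L := 4 * r * ε) hr.le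
    (by linarith) fun s hs => volume_annulus_section_le hr hε0 hε ?_).trans ?_)
  · rw [sub_zero] at hs
    nlinarith
  · rw [← ENNReal.ofReal_mul (by positivity)]
    exact ENNReal.ofReal_le_ofReal (by nlinarith)


theorem annulus_inter_union_measure_upper_bound :
    ∃ c₂ : ℝ, 0 < c₂ ∧
      ∀ (r ε : ℝ), 0 < r → 0 < ε → ε ≤ 1 →
      ∀ (k : ℕ) (x : Fin k → EuclideanSpace ℝ (Fin 2)),
        (∀ i j, i ≠ j → r * Real.sqrt ε ≤ dist (x i) (x j)) →
      ∀ i : Fin k,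
        (volume (annulus (x i) r ε ∩
            ⋃ j ∈ {j : Fin k | j ≠ i},
              (annulus (x j) r ε ∪ Metric.closedBall (x j) (r * Real.sqrt ε)))).toReal ≤
          c₂ * k * (volume (annulus 0 r ε)).toReal * Real.sqrt ε := by
  refine ⟨16, by norm_num, fun r ε hr hε0 hε1 k x hx i => ?_⟩
  have hq : 0 < √ε := Real.sqrt_pos.2 hε0
  have hk : (1 : ℝ) ≤ k := by exact_mod_cast i.pos
  have hA := sq_mul_le_volume_annulus hr.le hε0.le hε1
  rcases le_total ε (1 / 64) with hε | hε
  · have hpair : ∀ j ∈ {j : Fin k | j ≠ i}, volume (annulus (x i) r ε ∩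
        (annulus (x j) r ε ∪ Metric.closedBall (x j) (r * √ε))) ≤
          ENNReal.ofReal (16 * r ^ 2 * ε * √ε) := by
      intro j hj
      have hij := hx i j (Ne.symm hj)
      have hne : x i ≠ x j := dist_pos.1 (lt_of_lt_of_le (by positivity) hij)
      rw [Set.inter_union_distrib_left]
      refine (measure_union_le _ _).trans ((add_le_add
        (volume_annulus_inter_annulus_le hr hε0 hε hij)
        (volume_annulus_inter_closedBall_le hr hε0.le hε hne)).trans ?_)
      rw [← ENNReal.ofReal_add (by positivity) (by positivity)]
      exact ENNReal.ofReal_le_ofReal (by linarith)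
    have hunion : volume (annulus (x i) r ε ∩ ⋃ j ∈ {j : Fin k | j ≠ i},
        (annulus (x j) r ε ∪ Metric.closedBall (x j) (r * √ε))) ≤
          ENNReal.ofReal (k * (16 * r ^ 2 * ε * √ε)) := by
      rw [Set.inter_iUnion₂]
      refine (measure_iUnion_fintype_le _ _).trans
        ((Finset.sum_le_card_nsmul _ _ (ENNReal.ofReal (16 * r ^ 2 * ε * √ε))
          fun j _ => ?_).trans ?_)
      · by_cases hj : j ∈ {j : Fin k | j ≠ i}
        · simpa only [hj, Set.iUnion_true] using hpair j hj
        · simp only [hj, measure_empty, Set.iUnion_of_empty, zero_le]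
      · rw [Finset.card_univ, Fintype.card_fin, nsmul_eq_mul, ENNReal.ofReal_mul k.cast_nonneg,
          ENNReal.ofReal_natCast]
    refine (ENNReal.toReal_le_of_le_ofReal (by positivity) hunion).trans ?_
    calc (k : ℝ) * (16 * r ^ 2 * ε * √ε) = 16 * k * (r ^ 2 * ε) * √ε := by ring
      _ ≤ _ := by gcongr
  · have hq8 : 1 / 8 ≤ √ε := Real.le_sqrt_of_sq_le (by linarith)
    have hle := ENNReal.toReal_mono (volume_annulus_ne_top (x i) r ε)
      (measure_mono (Set.inter_subset_left (s := annulus (x i) r ε)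
        (t := ⋃ j ∈ {j : Fin k | j ≠ i},
          (annulus (x j) r ε ∪ Metric.closedBall (x j) (r * √ε)))))
    rw [volume_annulus_eq_volume_annulus_zero (x i)] at hle
    refine hle.trans ?_
    have hV : 0 ≤ (volume (annulus 0 r ε)).toReal := ENNReal.toReal_nonneg
    have hkq : 1 ≤ 16 * (k * √ε) := by nlinarith
    nlinarith [mul_le_mul_of_nonneg_right hkq hV]
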